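/- The class of weakly-sticky programs is not closed under the magic-sets rewriting MagicD+: there exist a WS Datalog+ program P and a conjunctive query Q such that the program P_m output by MagicD+ on P and Q is neither WS nor in SCh(S^rank) (P_m does not have the S^rank-stickiness property of the chase). -/

import Mathlib

namespace Datalog

/-- A relational schema: predicates with fixed finite arities. -/
structure Schema where
  Pred : Type
  arity : Pred → ℕ

/-- A position `p[i]` of a schema. -/
abbrev Position (S : Schema) : Type := Σ p : S.Pred, Fin (S.arity p)

/-- An atom over terms of type `τ`. -/
structure Atom (S : Schema) (τ : Type) where
  pred : S.Pred
  args : Fin (S.arity pred) → τ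

namespace Atom
variable {S : Schema} {τ τ' : Type}

def map (f : τ → τ') (A : Atom S τ) : Atom S τ' := ⟨A.pred, fun i => f (A.args i)⟩

/-- The term `t` occurs in the atom `A`. -/
def occurs (A : Atom S τ) (t : τ) : Prop := ∃ i, A.args i = t

/-- The set of positions at which the term `t` occurs in `A`. -/
def posOf (A : Atom S τ) (t : τ) : Set (Position S) :=
  {π | ∃ i, A.args i = t ∧ π = ⟨A.pred, i⟩}

end Atom

/-- Ground values: constants from `C` or labeled nulls from `Nl`. -/
abbrev Val (C Nl : Type) : Type := C ⊕ Nl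

/-- Terms of rules and queries: variables from `V` or constants from `C`. -/
abbrev RTerm (V C : Type) : Type := V ⊕ C

/-- A tuple-generating dependency (existential rule). -/
structure Rule (S : Schema) (V C : Type) where
  body : List (Atom S (RTerm V C))
  head : Atom S (RTerm V C)
  exVars : Set V

namespace Rule
variable {S : Schema} {V C : Type}

def occursInBody (σ : Rule S V C) (X : V) : Prop := ∃ A ∈ σ.body, A.occurs (Sum.inl X)
def occursInHead (σ : Rule S V C) (X : V) : Prop := σ.head.occurs (Sum.inl X)
def bodyPos (σ : Rule S V C) (X : V) : Set (Position S) :=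
  {π | ∃ A ∈ σ.body, π ∈ A.posOf (Sum.inl X)}
def headPos (σ : Rule S V C) (X : V) : Set (Position S) := σ.head.posOf (Sum.inl X)
def varPos (σ : Rule S V C) (X : V) : Set (Position S) := σ.bodyPos X ∪ σ.headPos X

/-- `X` occurs more than once in the body of `σ` (a repeated/join variable). -/
def repeatedInBody (σ : Rule S V C) (X : V) : Prop :=
  ∃ (k₁ k₂ : Fin σ.body.length) (i₁ : Fin (S.arity (σ.body.get k₁).pred))
    (i₂ : Fin (S.arity (σ.body.get k₂).pred)),
    (σ.body.get k₁).args i₁ = Sum.inl X ∧ (σ.body.get k₂).args i₂ = Sum.inl X ∧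
    (⟨k₁, i₁⟩ : Σ k : Fin σ.body.length, Fin (S.arity (σ.body.get k).pred)) ≠ ⟨k₂, i₂⟩

end Rule

/-- A Datalog⁺ program: a set of existential rules together with an
extensional database of atoms over constants. -/
structure Program (S : Schema) (V C Nl : Type) where
  rules : Set (Rule S V C)
  db : Set (Atom S C)

/-- An instance: a set of ground atoms over constants and nulls. -/
abbrev Instance (S : Schema) (C Nl : Type) : Type := Set (Atom S (Val C Nl))

def Program.dbInst {S : Schema} {V C Nl : Type} (P : Program S V C Nl) : Instance S C Nl :=
  (Atom.map (Sum.inl : C → Val C Nl)) '' P.db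

/-- Substitution of values for rule terms, via an assignment of variables. -/
def substT {V C Nl : Type} (θ : V → Val C Nl) : RTerm V C → Val C Nl
  | Sum.inl X => θ X
  | Sum.inr c => Sum.inl c

def Atom.subst {S : Schema} {V C Nl : Type} (A : Atom S (RTerm V C)) (θ : V → Val C Nl) :
    Atom S (Val C Nl) := A.map (substT θ)

/-- `I ⊨ body[θ]`. -/
def bodySat {S : Schema} {V C Nl : Type} (I : Instance S C Nl)
    (body : List (Atom S (RTerm V C))) (θ : V → Val C Nl) : Prop :=
  ∀ A ∈ body, A.subst θ ∈ I

/-- Satisfaction of a TGD by an instance. -/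
def Rule.satisfied {S : Schema} {V C Nl : Type} (I : Instance S C Nl) (σ : Rule S V C) : Prop :=
  ∀ θ : V → Val C Nl, bodySat I σ.body θ →
    ∃ θ' : V → Val C Nl, (∀ X, X ∉ σ.exVars → θ' X = θ X) ∧ σ.head.subst θ' ∈ I

/-- The models of a program. -/
def Program.Mod {S : Schema} {V C Nl : Type} (P : Program S V C Nl) : Set (Instance S C Nl) :=
  {I | P.dbInst ⊆ I ∧ ∀ σ ∈ P.rules, σ.satisfied I}

/-- A conjunctive query with body atoms and a list of free (answer) variables. -/
structure CQ (S : Schema) (V C : Type) where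
  body : List (Atom S (RTerm V C))
  free : List V

def CQ.answers {S : Schema} {V C Nl : Type} (Q : CQ S V C) (I : Instance S C Nl) :
    Set (Fin Q.free.length → Val C Nl) :=
  {t | ∃ θ : V → Val C Nl, bodySat I Q.body θ ∧ ∀ i : Fin Q.free.length, θ (Q.free.get i) = t i}

/-- The certain answers `ans(Q,P)`. -/
def certAns {S : Schema} {V C Nl : Type} (Q : CQ S V C) (P : Program S V C Nl) :
    Set (Fin Q.free.length → Val C Nl) :=
  ⋂ I ∈ P.Mod, Q.answers I

/-- The variables of a conjunctive query. -/
def CQ.vars {S : Schema} {V C : Type} (Q : CQ S V C) : Set V :=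
  {X | (∃ A ∈ Q.body, A.occurs (Sum.inl X)) ∨ X ∈ Q.free}

/-- The number of variables of a conjunctive query. -/
noncomputable def CQ.nvars {S : Schema} {V C : Type} (Q : CQ S V C) : ℕ := Q.vars.ncard

/-! ## Dependency graph, rank, weak acyclicity -/

/-- Ordinary edge of the dependency graph `DG(P^r)`:
from a body position `π` of a ∀-variable `X` occurring in the head to a head position of `X`. -/
def dgEdge {S : Schema} {V C : Type} (Pr : Set (Rule S V C)) (π π' : Position S) : Prop :=
  ∃ σ ∈ Pr, ∃ X : V, X ∉ σ.exVars ∧ σ.occursInHead X ∧ π ∈ σ.bodyPos X ∧ π' ∈ σ.headPos X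

/-- Special edge of the dependency graph: from a body position `π` of a ∀-variable occurring in
the head to a head position of an ∃-variable. -/
def dgSpecial {S : Schema} {V C : Type} (Pr : Set (Rule S V C)) (π π' : Position S) : Prop :=
  ∃ σ ∈ Pr, (∃ X : V, X ∉ σ.exVars ∧ σ.occursInHead X ∧ π ∈ σ.bodyPos X) ∧
    ∃ Z ∈ σ.exVars, π' ∈ σ.headPos Z

/-- Any (ordinary or special) edge of the dependency graph. -/
def dgAnyEdge {S : Schema} {V C : Type} (Pr : Set (Rule S V C)) (π π' : Position S) : Prop :=
  dgEdge Pr π π' ∨ dgSpecial Pr π π'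

/-- `SpecPath Pr π k`: there is a (finite) path of the dependency graph ending at `π`
containing exactly `k` special edges. -/
inductive SpecPath {S : Schema} {V C : Type} (Pr : Set (Rule S V C)) : Position S → ℕ → Prop
  | refl (π : Position S) : SpecPath Pr π 0
  | edge {π π' : Position S} {k : ℕ} : SpecPath Pr π k → dgEdge Pr π π' → SpecPath Pr π' k
  | special {π π' : Position S} {k : ℕ} :
      SpecPath Pr π k → dgSpecial Pr π π' → SpecPath Pr π' (k + 1)

/-- A position has finite rank iff the number of special edges over all (finite or infinite)
paths ending at it is bounded. -/
def finiteRank {S : Schema} {V C : Type} (Pr : Set (Rule S V C)) (π : Position S) : Prop :=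
  ∃ n : ℕ, ∀ k : ℕ, SpecPath Pr π k → k ≤ n

/-- `Π_F(P^r)`: the finite-rank positions. -/
def PiF {S : Schema} {V C : Type} (Pr : Set (Rule S V C)) : Set (Position S) :=
  {π | finiteRank Pr π}

/-! ## Existential dependency graph -/

/-- The target set `T(Z)` of the ∃-variable `Z` of the rule `σ₀`: the smallest set of positions
containing the head positions of `Z` and the head positions of every body
variable `X` (of any rule) all of whose body positions lie in the set. -/
inductive InTarget {S : Schema} {V C : Type} (Pr : Set (Rule S V C)) (σ₀ : Rule S V C) (Z : V) :
    Position S → Prop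
  | hd {π : Position S} : π ∈ σ₀.headPos Z → InTarget Pr σ₀ Z π
  | prop {σ' : Rule S V C} {X : V} {π : Position S} (hσ' : σ' ∈ Pr) (hbX : σ'.occursInBody X)
      (hB : ∀ π' ∈ σ'.bodyPos X, InTarget Pr σ₀ Z π') (hπ : π ∈ σ'.headPos X) :
      InTarget Pr σ₀ Z π

/-- Edge of the existential dependency graph `EDG(P^r)` between ∃-variables
(represented as a pair of a rule and one of its ∃-variables). -/
def edgEdge {S : Schema} {V C : Type} (Pr : Set (Rule S V C)) :
    Rule S V C × V → Rule S V C × V → Prop := fun p q =>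
  p.1 ∈ Pr ∧ q.1 ∈ Pr ∧ p.2 ∈ p.1.exVars ∧ q.2 ∈ q.1.exVars ∧
    ∃ X : V, q.1.occursInBody X ∧ ∀ π ∈ q.1.bodyPos X, InTarget Pr p.1 p.2 π

/-- The ∃-variable `Z` of rule `σ` lies on a cycle of `EDG(P^r)`. -/
def onEDGCycle {S : Schema} {V C : Type} (Pr : Set (Rule S V C)) (σ : Rule S V C) (Z : V) :
    Prop := Relation.TransGen (edgEdge Pr) (σ, Z) (σ, Z)

/-- `Π^∃_F(P^r)`: the finite-existential positions, i.e. those not in the target set of any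
∃-variable lying on a cycle of the existential dependency graph. -/
def PiFE {S : Schema} {V C : Type} (Pr : Set (Rule S V C)) : Set (Position S) :=
  {π | ¬ ∃ (σ : Rule S V C) (Z : V), σ ∈ Pr ∧ Z ∈ σ.exVars ∧ onEDGCycle Pr σ Z ∧
    InTarget Pr σ Z π}

/-- `EDGPathLen Pr p k`: there is a path of length `k` (number of edges) in `EDG(P^r)`
ending at the ∃-variable node `p`. -/
inductive EDGPathLen {S : Schema} {V C : Type} (Pr : Set (Rule S V C)) :
    Rule S V C × V → ℕ → Prop
  | refl (p : Rule S V C × V) (h₁ : p.1 ∈ Pr) (h₂ : p.2 ∈ p.1.exVars) : EDGPathLen Pr p 0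
  | step {p q : Rule S V C × V} {k : ℕ} :
      EDGPathLen Pr p k → edgEdge Pr p q → EDGPathLen Pr q (k + 1)

/-- The ∃-rank of the position `π` is at most `i`. -/
def exRankLe {S : Schema} {V C : Type} (Pr : Set (Rule S V C)) (π : Position S) (i : ℕ) : Prop :=
  ∀ (σ : Rule S V C) (Z : V) (k : ℕ), EDGPathLen Pr (σ, Z) k → InTarget Pr σ Z π → k ≤ i

/-- The position `π` has finite ∃-rank. -/
def finiteExRank {S : Schema} {V C : Type} (Pr : Set (Rule S V C)) (π : Position S) : Prop :=
  ∃ n : ℕ, exRankLe Pr π n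

/-! ## The chase -/

/-- Active domain of an instance. -/
def adom {S : Schema} {C Nl : Type} (I : Instance S C Nl) : Set (Val C Nl) :=
  {v | ∃ A ∈ I, A.occurs v}

/-- A chase sequence of a program: starting from the extensional database, rules are applied
with assignments mapping the existential variables to fresh nulls; every applicable pair of a
rule and an assignment is applied exactly once (fairness/exhaustiveness). -/
structure ChaseSeq {S : Schema} {V C Nl : Type} (P : Program S V C Nl) where
  inst : ℕ → Instance S C Nl
  stepAt : ℕ → Option (Rule S V C × (V → Val C Nl))
  init : inst 0 = P.dbInst
  step_none : ∀ n, stepAt n = none → inst (n + 1) = inst n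
  step_some : ∀ n σ θ, stepAt n = some (σ, θ) →
    σ ∈ P.rules ∧ bodySat (inst n) σ.body θ ∧
    (∀ Z ∈ σ.exVars, ∃ ν : Nl, θ Z = Sum.inr ν ∧ (Sum.inr ν : Val C Nl) ∉ adom (inst n)) ∧
    (∀ Z ∈ σ.exVars, ∀ Z' ∈ σ.exVars, θ Z = θ Z' → Z = Z') ∧
    inst (n + 1) = insert (σ.head.subst θ) (inst n)
  once : ∀ m n σ θ θ', stepAt m = some (σ, θ) → stepAt n = some (σ, θ') →
    (∀ X, σ.occursInBody X → θ X = θ' X) → m = n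
  fair : ∀ n σ θ, σ ∈ P.rules → bodySat (inst n) σ.body θ →
    ∃ m θ', stepAt m = some (σ, θ') ∧ ∀ X, σ.occursInBody X → θ' X = θ X

/-- The (result of the) chase: the union of all instances of the chase sequence. -/
def ChaseSeq.result {S : Schema} {V C Nl : Type} {P : Program S V C Nl} (ch : ChaseSeq P) :
    Instance S C Nl := ⋃ n, ch.inst n

/-- The set of values appearing at position `π` in instance `I`. -/
def valuesAt {S : Schema} {C Nl : Type} (I : Instance S C Nl) (π : Position S) :
    Set (Val C Nl) :=
  {v | ∃ A ∈ I, ∃ i, A.args i = v ∧ (⟨A.pred, i⟩ : Position S) = π}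

/-- `ΠFin(P)`: the finite positions of a program, i.e. the positions in which only finitely
many distinct values occur in the chase of `P`. -/
def finitePositions {S : Schema} {V C Nl : Type} (P : Program S V C Nl) : Set (Position S) :=
  {π | ∀ ch : ChaseSeq P, (valuesAt ch.result π).Finite}

/-- The chase relation: relates each body atom of a chase step to the produced atom. -/
def rchase {S : Schema} {V C Nl : Type} {P : Program S V C Nl} (ch : ChaseSeq P) :
    Atom S (Val C Nl) → Atom S (Val C Nl) → Prop := fun b a =>
  ∃ n σ θ, ch.stepAt n = some (σ, θ) ∧ (∃ B ∈ σ.body, b = B.subst θ) ∧ a = σ.head.subst θ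

/-- The chase derivation relation: the transitive closure of the chase relation. -/
def dchase {S : Schema} {V C Nl : Type} {P : Program S V C Nl} (ch : ChaseSeq P) :
    Atom S (Val C Nl) → Atom S (Val C Nl) → Prop := Relation.TransGen (rchase ch)

/-- Stickiness of a chase sequence relative to a set `Vp` of positions: whenever a rule is
applied whose body repeats a variable `X` occurring at no position of `Vp`, the value `θ(X)`
occurs in the produced atom and in every atom derived from it. -/
def ChaseSeq.stickyOn {S : Schema} {V C Nl : Type} {P : Program S V C Nl} (ch : ChaseSeq P)
    (Vp : Set (Position S)) : Prop :=
  ∀ n σ θ, ch.stepAt n = some (σ, θ) →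
    ∀ X : V, σ.repeatedInBody X → (∀ π ∈ σ.varPos X, π ∉ Vp) →
      (σ.head.subst θ).occurs (θ X) ∧
      ∀ B : Atom S (Val C Nl), dchase ch (σ.head.subst θ) B → B.occurs (θ X)

/-- A selection function: returns, for every program, a set of finite positions. -/
def IsSelection {S : Schema} {V C Nl : Type}
    (sel : Program S V C Nl → Set (Position S)) : Prop :=
  ∀ P : Program S V C Nl, sel P ⊆ finitePositions P

/-- `SCh(S)`: the semantic class of programs with the `S`-stickiness property of the chase. -/
def SCh {S : Schema} {V C Nl : Type} (sel : Program S V C Nl → Set (Position S)) :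
    Set (Program S V C Nl) :=
  {P | ∀ ch : ChaseSeq P, ch.stickyOn (sel P)}

/-! ## The marking procedure, sticky, WS and JWS programs -/

/-- The marking procedure: `Marked Pr σ X` holds iff the body occurrences of `X` in `σ`
get marked. -/
inductive Marked {S : Schema} {V C : Type} (Pr : Set (Rule S V C)) : Rule S V C → V → Prop
  | prelim {σ : Rule S V C} {X : V} (hσ : σ ∈ Pr) (hb : σ.occursInBody X)
      (hh : ¬ σ.occursInHead X) : Marked Pr σ X
  | prop {σ : Rule S V C} {X : V} {π : Position S} {σ' : Rule S V C} {Y : V}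
      (hσ : σ ∈ Pr) (hm : Marked Pr σ X) (hπ : π ∈ σ.bodyPos X) (hσ' : σ' ∈ Pr)
      (hY : π ∈ σ'.headPos Y) (hbY : σ'.occursInBody Y) : Marked Pr σ' Y

/-- Weakly-sticky set of rules. -/
def WS {S : Schema} {V C : Type} (Pr : Set (Rule S V C)) : Prop :=
  ∀ σ ∈ Pr, ∀ X : V, σ.repeatedInBody X →
    ¬ Marked Pr σ X ∨ ∃ π ∈ σ.varPos X, π ∈ PiF Pr

/-- Joint-weakly-sticky set of rules. -/
def JWS {S : Schema} {V C : Type} (Pr : Set (Rule S V C)) : Prop :=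
  ∀ σ ∈ Pr, ∀ X : V, σ.repeatedInBody X →
    ¬ Marked Pr σ X ∨ ∃ π ∈ σ.varPos X, π ∈ PiFE Pr

end Datalog

/-! ## The SChQA query answering algorithm -/

namespace Datalog

/-- A configuration of SChQA: the current instance, the set of frozen nulls, and the number of
resumptions performed so far. -/
structure Config (S : Schema) (C Nl : Type) where
  inst : Instance S C Nl
  frozen : Set Nl
  phase : ℕ

/-- Isomorphism of atoms relative to a set `F` of frozen nulls: a bijective homomorphism that
is the identity on constants and on frozen nulls. -/
def AtomIso {S : Schema} {C Nl : Type} (F : Set Nl) (A B : Atom S (Val C Nl)) : Prop :=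
  ∃ e : Val C Nl ≃ Val C Nl, (∀ c : C, e (Sum.inl c) = Sum.inl c) ∧
    (∀ ν ∈ F, e (Sum.inr ν) = Sum.inr ν) ∧ A.map e = B

/-- A rule together with an assignment (already extended to the existential variables by fresh
nulls) is applicable over a configuration. -/
def Applicable {S : Schema} {V C Nl : Type} (cfg : Config S C Nl) (σ : Rule S V C)
    (θ : V → Val C Nl) : Prop :=
  bodySat cfg.inst σ.body θ ∧
  (∀ Z ∈ σ.exVars, ∃ ν : Nl, θ Z = Sum.inr ν ∧ (Sum.inr ν : Val C Nl) ∉ adom cfg.inst ∧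
    ν ∉ cfg.frozen) ∧
  (∀ Z ∈ σ.exVars, ∀ Z' ∈ σ.exVars, θ Z = θ Z' → Z = Z') ∧
  (∀ B ∈ cfg.inst, ¬ AtomIso cfg.frozen (σ.head.subst θ) B)

/-- The result of applying an applicable pair (Steps 2 and 3 of SChQA): the head atom is added
and its nulls occurring at positions of the selection are frozen. -/
def applyStep {S : Schema} {V C Nl : Type} (selPos : Set (Position S)) (cfg : Config S C Nl)
    (σ : Rule S V C) (θ : V → Val C Nl) : Config S C Nl where
  inst := insert (σ.head.subst θ) cfg.inst
  frozen := cfg.frozen ∪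
    {ν : Nl | ∃ π ∈ selPos, (Sum.inr ν : Val C Nl) ∈ valuesAt {σ.head.subst θ} π}
  phase := cfg.phase

/-- The nulls occurring in an instance. -/
def nullsOf {S : Schema} {C Nl : Type} (I : Instance S C Nl) : Set Nl :=
  {ν | (Sum.inr ν : Val C Nl) ∈ adom I}

/-- One step of SChQA: either apply an applicable rule–assignment pair (Steps 2–4), or, when
no pair is applicable and resumptions remain, resume by freezing every null (Step 5). -/
inductive SChQAStep {S : Schema} {V C Nl : Type} (P : Program S V C Nl)
    (selPos : Set (Position S)) (MQ : ℕ) : Config S C Nl → Config S C Nl → Prop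
  | apply {cfg : Config S C Nl} {σ : Rule S V C} {θ : V → Val C Nl}
      (hσ : σ ∈ P.rules) (happ : Applicable cfg σ θ) :
      SChQAStep P selPos MQ cfg (applyStep selPos cfg σ θ)
  | resume {cfg : Config S C Nl}
      (hno : ¬ ∃ σ ∈ P.rules, ∃ θ : V → Val C Nl, Applicable cfg σ θ)
      (hph : cfg.phase < MQ) :
      SChQAStep P selPos MQ cfg ⟨cfg.inst, cfg.frozen ∪ nullsOf cfg.inst, cfg.phase + 1⟩

/-- A final configuration: no applicable pair remains and all resumptions have been performed. -/
def IsFinalConfig {S : Schema} {V C Nl : Type} (P : Program S V C Nl) (MQ : ℕ)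
    (cfg : Config S C Nl) : Prop :=
  (¬ ∃ σ ∈ P.rules, ∃ θ : V → Val C Nl, Applicable cfg σ θ) ∧ cfg.phase = MQ

/-- A (complete) run of the algorithm SChQA with `MQ` resumptions. -/
structure SChQARun {S : Schema} {V C Nl : Type} (P : Program S V C Nl)
    (selPos : Set (Position S)) (MQ : ℕ) where
  cfg : ℕ → Config S C Nl
  init : cfg 0 = ⟨P.dbInst, ∅, 0⟩
  step : ∀ n, SChQAStep P selPos MQ (cfg n) (cfg (n + 1)) ∨
    (IsFinalConfig P MQ (cfg n) ∧ cfg (n + 1) = cfg n)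

/-- Step 6 of SChQA: the answers of `Q` in `I` containing no (possibly frozen) nulls. -/
def CQ.outAnswers {S : Schema} {V C Nl : Type} (Q : CQ S V C) (I : Instance S C Nl) :
    Set (Fin Q.free.length → Val C Nl) :=
  {t | t ∈ Q.answers I ∧ ∀ i, ∃ c : C, t i = Sum.inl c}

/-! ## The polynomial bound of Lemma `lm:ptime` -/

/-- `fbound s b i d`: `f_0(d) = d` and `f_{i+1}(d) = s·f_i(d)^b + f_i(d)`. -/
def fbound (s b : ℕ) : ℕ → ℕ → ℕ
  | 0, d => d
  | i + 1, d => s * (fbound s b i d) ^ b + fbound s b i d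

end Datalog

/-! ## The magic-sets rewriting MagicD⁺ -/

namespace Datalog

/-- Predicates of the rewritten program: original predicates, adorned predicates `p^α`, and
magic predicates `mg_p^α`. An adornment is a function from the positions of `p` to `Bool`
(`true` = bound `b`, `false` = free `f`). -/
inductive MPred (S : Schema) : Type
  | orig : S.Pred → MPred S
  | adorned : (p : S.Pred) → (Fin (S.arity p) → Bool) → MPred S
  | magic : (p : S.Pred) → (Fin (S.arity p) → Bool) → MPred S

/-- The number of bound positions of an adornment. -/
def boundCount {n : ℕ} (α : Fin n → Bool) : ℕ := (Finset.univ.filter fun i => α i = true).card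

/-- The schema of the rewritten program. -/
def MSchema (S : Schema) : Schema where
  Pred := MPred S
  arity := fun P => match P with
    | .orig p => S.arity p
    | .adorned p _ => S.arity p
    | .magic _ α => boundCount α

/-- The order-preserving enumeration of the bound positions of an adornment. -/
noncomputable def boundEnum {n : ℕ} (α : Fin n → Bool) : Fin (boundCount α) → Fin n :=
  fun j => ((Finset.univ.filter fun i => α i = true).orderIsoOfFin rfl j : Fin n)

/-- The adorned version `p^α` of an atom. -/
def adornedAtom {S : Schema} {τ : Type} (A : Atom S τ) (α : Fin (S.arity A.pred) → Bool) :
    Atom (MSchema S) τ := ⟨MPred.adorned A.pred α, A.args⟩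

/-- The magic atom `mg_p^α(..)` of an atom: its arguments are the arguments of the atom at the
bound positions. -/
noncomputable def magicAtom {S : Schema} {τ : Type} (A : Atom S τ)
    (α : Fin (S.arity A.pred) → Bool) : Atom (MSchema S) τ :=
  ⟨MPred.magic A.pred α, fun j => A.args (boundEnum α j)⟩

/-- A variable occurs in a list of atoms. -/
def occursInList {S : Schema} {V C : Type} (L : List (Atom S (RTerm V C))) (X : V) : Prop :=
  ∃ A ∈ L, A.occurs (Sum.inl X)

/-- The head variables of `σ` that are bound according to the head adornment `α`. -/
def boundHeadVars {S : Schema} {V C : Type} (σ : Rule S V C)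
    (α : Fin (S.arity σ.head.pred) → Bool) : Set V :=
  {X | ∃ i, α i = true ∧ σ.head.args i = Sum.inl X}

open Classical in
/-- The adornment of the `j`-th body atom `A` of the ordered body `L` according to the full
sideways-information-passing strategy determined by the ordering: a position is bound iff it
holds a constant, or a variable that is bound in the head or occurs in an earlier body atom. -/
noncomputable def sipsAdorn {S : Schema} {V C : Type} (Bv : Set V)
    (L : List (Atom S (RTerm V C))) (j : ℕ) (A : Atom S (RTerm V C)) :
    Fin (S.arity A.pred) → Bool :=
  fun i => match A.args i with
    | Sum.inr _ => true
    | Sum.inl X => if X ∈ Bv ∨ occursInList (L.take j) X then true else false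

/-- A head adornment is admissible for `σ` iff it binds no position of an ∃-variable. -/
def AdornOK {S : Schema} {V C : Type} (σ : Rule S V C)
    (α : Fin (S.arity σ.head.pred) → Bool) : Prop :=
  ∀ i X, α i = true → σ.head.args i = Sum.inl X → X ∉ σ.exVars

/-- The adornment of a query atom: positions holding constants are bound, positions holding
variables are free. -/
def queryAdorn {S : Schema} {V C : Type} (A : Atom S (RTerm V C)) :
    Fin (S.arity A.pred) → Bool := fun i => (A.args i).isRight

/-- The adorned predicates generated by MagicD⁺: those of the adorned query, propagated
through the rules via the chosen SIPS (an ordering `sips σ` of the body of each rule). -/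
inductive AdReach {S : Schema} {V C : Type} (Pr : Set (Rule S V C)) (Q : CQ S V C)
    (sips : Rule S V C → List (Atom S (RTerm V C))) :
    (Σ p : S.Pred, Fin (S.arity p) → Bool) → Prop
  | query {A : Atom S (RTerm V C)} (hA : A ∈ Q.body) : AdReach Pr Q sips ⟨A.pred, queryAdorn A⟩
  | step {σ : Rule S V C} (α : Fin (S.arity σ.head.pred) → Bool)
      (hσ : σ ∈ Pr) (h : AdReach Pr Q sips ⟨σ.head.pred, α⟩) (hok : AdornOK σ α)
      (k : Fin (sips σ).length) :
      AdReach Pr Q sips ⟨((sips σ).get k).pred,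
        sipsAdorn (boundHeadVars σ α) (sips σ) k ((sips σ).get k)⟩

/-- The adorned body of a rule for head adornment `α` and body ordering `sips σ`. -/
noncomputable def adornedBody {S : Schema} {V C : Type} (σ : Rule S V C)
    (α : Fin (S.arity σ.head.pred) → Bool) (sips : Rule S V C → List (Atom S (RTerm V C))) :
    List (Atom (MSchema S) (RTerm V C)) :=
  List.mapIdx (fun j A => adornedAtom A (sipsAdorn (boundHeadVars σ α) (sips σ) j A)) (sips σ)

/-- The adorned rule for `σ` and head adornment `α` (Step 2 of MagicD⁺ already incorporated:
the magic atom of the head is added to the body). -/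
noncomputable def adornedRule {S : Schema} {V C : Type} (σ : Rule S V C)
    (α : Fin (S.arity σ.head.pred) → Bool) (sips : Rule S V C → List (Atom S (RTerm V C))) :
    Rule (MSchema S) V C where
  body := magicAtom σ.head α :: adornedBody σ α sips
  head := adornedAtom σ.head α
  exVars := σ.exVars

/-- The magic rule generated by the occurrence of the `k`-th body atom of the adorned rule for
`σ` and `α`: its body consists of the magic atom of the head and the preceding adorned body
atoms, and its head is the magic atom of the `k`-th body atom. -/
noncomputable def magicRuleFor {S : Schema} {V C : Type} (σ : Rule S V C)
    (α : Fin (S.arity σ.head.pred) → Bool) (sips : Rule S V C → List (Atom S (RTerm V C)))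
    (k : Fin (sips σ).length) : Rule (MSchema S) V C where
  body := magicAtom σ.head α :: (adornedBody σ α sips).take k
  head := magicAtom ((sips σ).get k)
    (sipsAdorn (boundHeadVars σ α) (sips σ) k ((sips σ).get k))
  exVars := ∅

/-- A generic atom `p(x₁,…,x_n)` with pairwise distinct variables. -/
def genericAtom {S : Schema} (V C : Type) (vemb : ℕ → V) (p : S.Pred) :
    Atom S (RTerm V C) := ⟨p, fun i => Sum.inl (vemb i)⟩

/-- The rule loading the extensional data of `p` into its adorned version `p^α`, guarded by
the magic predicate (Step 4 of MagicD⁺). -/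
noncomputable def loadRule {S : Schema} (V C : Type) (vemb : ℕ → V) (p : S.Pred)
    (α : Fin (S.arity p) → Bool) : Rule (MSchema S) V C where
  body := [magicAtom (genericAtom V C vemb p) α,
    ⟨MPred.orig p, (genericAtom V C vemb p).args⟩]
  head := adornedAtom (genericAtom V C vemb p) α
  exVars := ∅

/-- The rules of the program output by MagicD⁺: the adorned rules, the magic rules, and the
loading rules for adorned predicates having extensional data. -/
inductive MagicRuleOf {S : Schema} {V C : Type} (Pr : Set (Rule S V C)) (D : Set (Atom S C))
    (Q : CQ S V C) (sips : Rule S V C → List (Atom S (RTerm V C))) (vemb : ℕ → V) :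
    Rule (MSchema S) V C → Prop
  | adorned {σ : Rule S V C} (α : Fin (S.arity σ.head.pred) → Bool)
      (hσ : σ ∈ Pr) (hr : AdReach Pr Q sips ⟨σ.head.pred, α⟩) (hok : AdornOK σ α) :
      MagicRuleOf Pr D Q sips vemb (adornedRule σ α sips)
  | magic {σ : Rule S V C} (α : Fin (S.arity σ.head.pred) → Bool)
      (hσ : σ ∈ Pr) (hr : AdReach Pr Q sips ⟨σ.head.pred, α⟩) (hok : AdornOK σ α)
      (k : Fin (sips σ).length) :
      MagicRuleOf Pr D Q sips vemb (magicRuleFor σ α sips k)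
  | load {p : S.Pred} {α : Fin (S.arity p) → Bool}
      (hr : AdReach Pr Q sips ⟨p, α⟩) (hdata : ∃ A ∈ D, A.pred = p) :
      MagicRuleOf Pr D Q sips vemb (loadRule V C vemb p α)

/-- The seed fact of a query atom: the magic atom of its adorned version, over the constants
of the query atom. -/
noncomputable def seedFact {S : Schema} {V C : Type} (c₀ : C) (A : Atom S (RTerm V C)) :
    Atom (MSchema S) C :=
  ⟨MPred.magic A.pred (queryAdorn A), fun j =>
    match A.args (boundEnum (queryAdorn A) j) with
    | Sum.inr c => c
    | Sum.inl _ => c₀⟩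

/-- The extensional database of the rewritten program: the original data (over the original
predicates), plus the seed facts of the query. -/
noncomputable def magicDB {S : Schema} {V C : Type} (c₀ : C) (D : Set (Atom S C))
    (Q : CQ S V C) : Set (Atom (MSchema S) C) :=
  ((fun A : Atom S C => (⟨MPred.orig A.pred, A.args⟩ : Atom (MSchema S) C)) '' D) ∪
    ((fun A => seedFact c₀ A) '' {A | A ∈ Q.body})

/-- The program `P_m` output by MagicD⁺ on `P` and `Q`, for the chosen full SIPS (body
orderings) `sips` and fresh variables `vemb`. -/
noncomputable def magicProgram {S : Schema} {V C Nl : Type} (c₀ : C) (P : Program S V C Nl)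
    (Q : CQ S V C) (sips : Rule S V C → List (Atom S (RTerm V C))) (vemb : ℕ → V) :
    Program (MSchema S) V C Nl where
  rules := {σ' | MagicRuleOf P.rules P.db Q sips vemb σ'}
  db := magicDB c₀ P.db Q

/-- The query `Q_m` output by MagicD⁺. -/
def magicQuery {S : Schema} {V C : Type} (Q : CQ S V C) : CQ (MSchema S) V C where
  body := Q.body.map (fun A => adornedAtom A (queryAdorn A))
  free := Q.free

/-- The bound positions of the rewritten program: the positions of adorned predicates
annotated `b`, and all positions of magic predicates. -/
def BoundPos (S : Schema) : Set (Position (MSchema S)) :=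
  {π | (∃ (p : S.Pred) (α : Fin (S.arity p) → Bool) (i : Fin (S.arity p)),
          α i = true ∧ π = ⟨MPred.adorned p α, i⟩) ∨
       (∃ (p : S.Pred) (α : Fin (S.arity p) → Bool) (j : Fin (boundCount α)),
          π = ⟨MPred.magic p α, j⟩)}

end Datalog

namespace Datalog.MagicCounterexample

/-- Two binary predicates: `r` is `true`, `s` is `false`. -/
abbrev Sch : Schema := ⟨Bool, fun _ => 2⟩

abbrev bf : Fin 2 → Bool := ![true, false]
abbrev fb : Fin 2 → Bool := ![false, true]

variable {τ : Type}

/-- A binary atom `p(t, u)` over the original schema. -/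
def atom (p : Bool) (t u : τ) : Atom Sch τ := ⟨p, (![t, u] : Fin 2 → τ)⟩

/-- The atom `p(t, u)` over the rewritten schema. -/
def og (p : Bool) (t u : τ) : Atom (MSchema Sch) τ := ⟨.orig p, (![t, u] : Fin 2 → τ)⟩

/-- The adorned atom `p^α(t, u)`. -/
def ad (p : Bool) (α : Fin 2 → Bool) (t u : τ) : Atom (MSchema Sch) τ :=
  ⟨.adorned p α, (![t, u] : Fin 2 → τ)⟩

/-- The magic atom `mg_p^α` all of whose arguments are `t`. -/
def mg (p : Bool) (α : Fin 2 → Bool) (t : τ) : Atom (MSchema Sch) τ := ⟨.magic p α, fun _ => t⟩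

lemma boundEnum_spec {n : ℕ} (α : Fin n → Bool) (j : Fin (boundCount α)) :
    α (boundEnum α j) = true := by
  have := ((Finset.univ.filter fun i => α i = true).orderIsoOfFin rfl j).2
  exact (Finset.mem_filter.1 this).2

lemma boundEnum_bf (j : Fin (boundCount bf)) : boundEnum bf j = 0 := by
  have h := boundEnum_spec bf j
  generalize boundEnum bf j = i at h ⊢
  revert h; revert i; decide

lemma boundEnum_fb (j : Fin (boundCount fb)) : boundEnum fb j = 1 := by
  have h := boundEnum_spec fb j
  generalize boundEnum fb j = i at h ⊢
  revert h; revert i; decide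

lemma magicAtom_bf (p : Bool) (t u : τ) : magicAtom (atom p t u) bf = mg p bf t := by
  have : (fun j => (![t, u] : Fin 2 → τ) (boundEnum bf j)) = fun _ => t := by
    funext j; rw [boundEnum_bf]; rfl
  exact congrArg (Atom.mk (S := MSchema Sch) (MPred.magic p bf)) this

lemma magicAtom_fb (p : Bool) (t u : τ) : magicAtom (atom p t u) fb = mg p fb u := by
  have : (fun j => (![t, u] : Fin 2 → τ) (boundEnum fb j)) = fun _ => u := by
    funext j; rw [boundEnum_fb]; rfl
  exact congrArg (Atom.mk (S := MSchema Sch) (MPred.magic p fb)) this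

lemma genericAtom_eq (p : Bool) :
    genericAtom (S := Sch) ℕ ℕ id p = atom p (Sum.inl 0) (Sum.inl 1) := by
  have : (fun i : Fin 2 => (Sum.inl (i : ℕ) : RTerm ℕ ℕ)) = ![Sum.inl 0, Sum.inl 1] := by
    funext i; fin_cases i <;> rfl
  exact congrArg (Atom.mk (S := Sch) p) this

@[simp] lemma og_inj {p q : Bool} {t u t' u' : τ} :
    og p t u = og q t' u' ↔ p = q ∧ t = t' ∧ u = u' := by
  constructor
  · intro h
    obtain ⟨h₁, h₂⟩ := Atom.mk.inj h
    cases h₁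
    have h₂ := eq_of_heq h₂
    exact ⟨rfl, congrFun h₂ (0 : Fin 2), congrFun h₂ (1 : Fin 2)⟩
  · rintro ⟨rfl, rfl, rfl⟩; rfl

@[simp] lemma ad_inj {p q : Bool} {α β : Fin 2 → Bool} {t u t' u' : τ} :
    ad p α t u = ad q β t' u' ↔ p = q ∧ α = β ∧ t = t' ∧ u = u' := by
  constructor
  · intro h
    obtain ⟨h₁, h₂⟩ := Atom.mk.inj h
    cases h₁
    have h₂ := eq_of_heq h₂
    exact ⟨rfl, rfl, congrFun h₂ (0 : Fin 2), congrFun h₂ (1 : Fin 2)⟩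
  · rintro ⟨rfl, rfl, rfl, rfl⟩; rfl

lemma mg_inj {p q : Bool} {α β : Fin 2 → Bool} {t t' : τ} (j : Fin (boundCount α)) :
    mg p α t = mg q β t' ↔ p = q ∧ α = β ∧ t = t' := by
  constructor
  · intro h
    obtain ⟨h₁, h₂⟩ := Atom.mk.inj h
    cases h₁
    exact ⟨rfl, rfl, congrFun (eq_of_heq h₂) j⟩
  · rintro ⟨rfl, rfl, rfl⟩; rfl

/-- The only argument place of a magic predicate adorned with `bf`. -/
def jbf : Fin (boundCount bf) := ⟨0, by decide⟩
/-- The only argument place of a magic predicate adorned with `fb`. -/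
def jfb : Fin (boundCount fb) := ⟨0, by decide⟩

@[simp] lemma mg_bf_inj {p q : Bool} {β : Fin 2 → Bool} {t t' : τ} :
    mg p bf t = mg q β t' ↔ p = q ∧ bf = β ∧ t = t' := mg_inj jbf
@[simp] lemma mg_fb_inj {p q : Bool} {β : Fin 2 → Bool} {t t' : τ} :
    mg p fb t = mg q β t' ↔ p = q ∧ fb = β ∧ t = t' := mg_inj jfb

@[simp] lemma bf_ne_fb : bf ≠ fb := by decide
@[simp] lemma fb_ne_bf : fb ≠ bf := by decide

@[simp] lemma og_ne_ad {p q : Bool} {β : Fin 2 → Bool} {t u t' u' : τ} :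
    og p t u ≠ ad q β t' u' := fun h => nomatch (Atom.mk.inj h).1
@[simp] lemma ad_ne_og {p q : Bool} {β : Fin 2 → Bool} {t u t' u' : τ} :
    ad q β t' u' ≠ og p t u := fun h => nomatch (Atom.mk.inj h).1
@[simp] lemma og_ne_mg {p q : Bool} {β : Fin 2 → Bool} {t u t' : τ} :
    og p t u ≠ mg q β t' := fun h => nomatch (Atom.mk.inj h).1
@[simp] lemma mg_ne_og {p q : Bool} {β : Fin 2 → Bool} {t u t' : τ} :
    mg q β t' ≠ og p t u := fun h => nomatch (Atom.mk.inj h).1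
@[simp] lemma ad_ne_mg {p q : Bool} {α β : Fin 2 → Bool} {t u t' : τ} :
    ad p α t u ≠ mg q β t' := fun h => nomatch (Atom.mk.inj h).1
@[simp] lemma mg_ne_ad {p q : Bool} {α β : Fin 2 → Bool} {t u t' : τ} :
    mg q β t' ≠ ad p α t u := fun h => nomatch (Atom.mk.inj h).1

@[simp] lemma map_og {τ' : Type} (f : τ → τ') (p : Bool) (t u : τ) :
    (og p t u).map f = og p (f t) (f u) := by
  have : (fun i => f ((![t, u] : Fin 2 → τ) i)) = ![f t, f u] := by
    funext i; fin_cases i <;> rfl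
  exact congrArg (Atom.mk (S := MSchema Sch) (MPred.orig p)) this

@[simp] lemma map_ad {τ' : Type} (f : τ → τ') (p : Bool) (α : Fin 2 → Bool) (t u : τ) :
    (ad p α t u).map f = ad p α (f t) (f u) := by
  have : (fun i => f ((![t, u] : Fin 2 → τ) i)) = ![f t, f u] := by
    funext i; fin_cases i <;> rfl
  exact congrArg (Atom.mk (S := MSchema Sch) (MPred.adorned p α)) this

@[simp] lemma map_mg {τ' : Type} (f : τ → τ') (p : Bool) (α : Fin 2 → Bool) (t : τ) :
    (mg p α t).map f = mg p α (f t) := rfl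

@[simp] lemma occurs_atom {p : Bool} {t u v : τ} : (atom p t u).occurs v ↔ t = v ∨ u = v :=
  Fin.exists_fin_two
@[simp] lemma occurs_og {p : Bool} {t u v : τ} : (og p t u).occurs v ↔ t = v ∨ u = v :=
  Fin.exists_fin_two
@[simp] lemma occurs_ad {p : Bool} {α : Fin 2 → Bool} {t u v : τ} :
    (ad p α t u).occurs v ↔ t = v ∨ u = v :=
  Fin.exists_fin_two
@[simp] lemma occurs_mg_bf {p : Bool} {t v : τ} : (mg p bf t).occurs v ↔ t = v :=
  ⟨fun ⟨_, h⟩ => h, fun h => ⟨jbf, h⟩⟩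
@[simp] lemma occurs_mg_fb {p : Bool} {t v : τ} : (mg p fb t).occurs v ↔ t = v :=
  ⟨fun ⟨_, h⟩ => h, fun h => ⟨jfb, h⟩⟩

/-- A variable as a rule term. -/
abbrev x (n : ℕ) : RTerm ℕ ℕ := Sum.inl n

/-- `r(X, Y) → ∃ Z, r(Y, Z)`. -/
def succRule : Rule Sch ℕ ℕ := ⟨[atom true (x 0) (x 1)], atom true (x 1) (x 2), {2}⟩

/-- `r(X, Y), r(Y, Z) → s(X, Y)`. -/
def joinRule : Rule Sch ℕ ℕ :=
  ⟨[atom true (x 0) (x 1), atom true (x 1) (x 2)], atom false (x 0) (x 1), ∅⟩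

/-- The program with the rules `succRule` and `joinRule` over the data `r(1, 0)`. -/
def prog : Program Sch ℕ ℕ ℕ := ⟨{succRule, joinRule}, {atom true 1 0}⟩

/-- The query `∃ X, s(0, X)`. -/
def query : CQ Sch ℕ ℕ := ⟨[atom false (Sum.inr 0) (x 0)], []⟩

/-- The body of a rule in its given order. -/
abbrev sips (σ : Rule Sch ℕ ℕ) : List (Atom Sch (RTerm ℕ ℕ)) := σ.body

lemma not_marked_joinRule {σ : Rule Sch ℕ ℕ} {X : ℕ} (h : Marked prog.rules σ X) :
    ¬ (σ = joinRule ∧ X = 1) := by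
  rintro ⟨rfl, rfl⟩
  cases h with
  | prelim hσ hb hh => exact hh (by simp [joinRule, Rule.occursInHead])
  | prop hσ hm hπ hσ' hY hbY =>
    obtain ⟨i, -, rfl⟩ := hY
    obtain ⟨A, hA, j, -, hj⟩ := hπ
    have h₁ : false = A.pred := congrArg Sigma.fst hj
    rcases hσ with rfl | rfl
    · simp only [succRule, List.mem_singleton] at hA
      subst hA; exact absurd h₁ (by decide)
    · simp only [joinRule, List.mem_cons, List.not_mem_nil, or_false] at hA
      rcases hA with rfl | rfl <;> exact absurd h₁ (by decide)

lemma ws_prog : WS prog.rules := by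
  intro σ hσ X hX
  left
  intro hm
  obtain ⟨k₁, k₂, i₁, i₂, h₁, h₂, hne⟩ := hX
  rcases hσ with rfl | rfl
  · change Fin 1 at k₁ k₂
    obtain rfl := Subsingleton.elim k₁ 0
    obtain rfl := Subsingleton.elim k₂ 0
    change Fin 2 at i₁ i₂
    fin_cases i₁ <;> fin_cases i₂ <;> first | exact hne rfl | skip
    · exact absurd (h₁.trans h₂.symm) (by simp [succRule, atom])
    · exact absurd (h₁.trans h₂.symm) (by simp [succRule, atom])
  · have hX : X ≠ 1 := fun h => not_marked_joinRule hm ⟨rfl, h⟩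
    change Fin 2 at k₁ k₂
    fin_cases k₁ <;> fin_cases k₂ <;> change Fin 2 at i₁ i₂ <;>
      fin_cases i₁ <;> fin_cases i₂ <;> first
        | exact hne rfl
        | exact hX (Sum.inl.inj h₁).symm
        | exact hX (Sum.inl.inj h₂).symm
        | exact absurd (h₁.trans h₂.symm) (by simp [joinRule, atom])

/-- The rewriting of `prog` for `query`. -/
noncomputable abbrev mprog : Program (MSchema Sch) ℕ ℕ ℕ := magicProgram 0 prog query sips id

/-- `mg_r^bf(Y), r^fb(X, Y) → ∃ Z, r^bf(Y, Z)`. -/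
def A1 : Rule (MSchema Sch) ℕ ℕ :=
  ⟨[mg true bf (x 1), ad true fb (x 0) (x 1)], ad true bf (x 1) (x 2), {2}⟩
/-- `mg_s^bf(X), r^bf(X, Y), r^bf(Y, Z) → s^bf(X, Y)`. -/
def A2 : Rule (MSchema Sch) ℕ ℕ :=
  ⟨[mg false bf (x 0), ad true bf (x 0) (x 1), ad true bf (x 1) (x 2)], ad false bf (x 0) (x 1), ∅⟩
/-- `mg_r^bf(Y) → mg_r^fb(Y)`. -/
def M1 : Rule (MSchema Sch) ℕ ℕ := ⟨[mg true bf (x 1)], mg true fb (x 1), ∅⟩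
/-- `mg_s^bf(X) → mg_r^bf(X)`. -/
def M2 : Rule (MSchema Sch) ℕ ℕ := ⟨[mg false bf (x 0)], mg true bf (x 0), ∅⟩
/-- `mg_s^bf(X), r^bf(X, Y) → mg_r^bf(Y)`. -/
def M3 : Rule (MSchema Sch) ℕ ℕ :=
  ⟨[mg false bf (x 0), ad true bf (x 0) (x 1)], mg true bf (x 1), ∅⟩
/-- `mg_r^bf(X), r(X, Y) → r^bf(X, Y)`. -/
def L1 : Rule (MSchema Sch) ℕ ℕ :=
  ⟨[mg true bf (x 0), og true (x 0) (x 1)], ad true bf (x 0) (x 1), ∅⟩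
/-- `mg_r^fb(Y), r(X, Y) → r^fb(X, Y)`. -/
def L2 : Rule (MSchema Sch) ℕ ℕ :=
  ⟨[mg true fb (x 1), og true (x 0) (x 1)], ad true fb (x 0) (x 1), ∅⟩

lemma mem_boundHeadVars_succRule (X : ℕ) : X ∈ boundHeadVars succRule bf ↔ X = 1 := by
  refine Fin.exists_fin_two.trans ?_
  simp [succRule, atom, eq_comm]

lemma mem_boundHeadVars_joinRule (X : ℕ) : X ∈ boundHeadVars joinRule bf ↔ X = 0 := by
  refine Fin.exists_fin_two.trans ?_
  simp [joinRule, atom, eq_comm]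

lemma sipsAdorn_succRule :
    sipsAdorn (boundHeadVars succRule bf) (sips succRule) 0 (atom true (x 0) (x 1)) = fb := by
  funext i
  change Fin 2 at i
  fin_cases i <;> simp [sipsAdorn, atom, mem_boundHeadVars_succRule, occursInList]

lemma sipsAdorn_joinRule_zero :
    sipsAdorn (boundHeadVars joinRule bf) (sips joinRule) 0 (atom true (x 0) (x 1)) = bf := by
  funext i
  change Fin 2 at i
  fin_cases i <;> simp [sipsAdorn, atom, mem_boundHeadVars_joinRule, occursInList]

lemma sipsAdorn_joinRule_one :
    sipsAdorn (boundHeadVars joinRule bf) (sips joinRule) 1 (atom true (x 1) (x 2)) = bf := by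
  have h : ∀ X, occursInList ((sips joinRule).take 1) X ↔ 0 = X ∨ 1 = X := by
    intro X; simp [occursInList, sips, joinRule]
  funext i
  change Fin 2 at i
  fin_cases i <;> simp [sipsAdorn, mem_boundHeadVars_joinRule, h] <;> simp [atom]

lemma queryAdorn_query : queryAdorn (atom false (Sum.inr 0) (x 0) : Atom Sch (RTerm ℕ ℕ)) = bf := by
  funext i
  change Fin 2 at i
  fin_cases i <;> rfl

lemma adornOK_succRule : AdornOK succRule bf := by
  intro i X
  change Fin 2 at i
  fin_cases i
  · simp [succRule, atom]; omega
  · simp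

lemma not_adornOK_succRule : ¬ AdornOK succRule fb :=
  fun h => h (1 : Fin 2) 2 rfl rfl rfl

lemma adornOK_joinRule : AdornOK joinRule bf := fun _ _ _ _ h => h

/-- The adorned predicates over `Sch`. -/
abbrev AdPred : Type := Σ p : Sch.Pred, Fin (Sch.arity p) → Bool

lemma eq_of_adReach {q : AdPred} (h : AdReach prog.rules query sips q) :
    q = ⟨false, bf⟩ ∨ q = ⟨true, bf⟩ ∨ q = ⟨true, fb⟩ := by
  induction h with
  | query hA =>
    obtain rfl := List.mem_singleton.1 hA
    left
    exact congrArg (Sigma.mk (β := fun p : Sch.Pred => Fin (Sch.arity p) → Bool) false)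
      queryAdorn_query
  | step α hσ h hok k ih =>
    rcases hσ with rfl | rfl
    · have hα : α = bf ∨ α = fb := by
        rcases ih with ih | ih | ih
        · exact absurd (congrArg Sigma.fst ih).symm Bool.false_ne_true
        · exact Or.inl (eq_of_heq (Sigma.mk.inj ih).2)
        · exact Or.inr (eq_of_heq (Sigma.mk.inj ih).2)
      rcases hα with rfl | rfl
      · right; right
        change Fin 1 at k
        obtain rfl := Subsingleton.elim k 0
        exact congrArg (Sigma.mk (β := fun p : Sch.Pred => Fin (Sch.arity p) → Bool) true)
          sipsAdorn_succRule
      · exact absurd hok not_adornOK_succRule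
    · have hα : α = bf := by
        rcases ih with ih | ih | ih
        · exact eq_of_heq (Sigma.mk.inj ih).2
        · exact absurd (congrArg Sigma.fst ih) Bool.false_ne_true
        · exact absurd (congrArg Sigma.fst ih) Bool.false_ne_true
      subst hα
      right; left
      change Fin 2 at k
      fin_cases k
      · exact congrArg (Sigma.mk (β := fun p : Sch.Pred => Fin (Sch.arity p) → Bool) true)
          sipsAdorn_joinRule_zero
      · exact congrArg (Sigma.mk (β := fun p : Sch.Pred => Fin (Sch.arity p) → Bool) true)
          sipsAdorn_joinRule_one

lemma adReach_s_bf : AdReach prog.rules query sips (⟨false, bf⟩ : AdPred) := by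
  have h := AdReach.query (Pr := prog.rules) (Q := query) (sips := sips) (List.mem_singleton.2 rfl)
  rw [queryAdorn_query] at h
  exact h

lemma adReach_r_bf : AdReach prog.rules query sips (⟨true, bf⟩ : AdPred) := by
  have h := AdReach.step (σ := joinRule) bf (Or.inr rfl) adReach_s_bf adornOK_joinRule
    (0 : Fin 2)
  have e := sipsAdorn_joinRule_zero
  exact e ▸ h

lemma adReach_r_fb : AdReach prog.rules query sips (⟨true, fb⟩ : AdPred) := by
  have h := AdReach.step (σ := succRule) bf (Or.inl rfl) adReach_r_bf adornOK_succRule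
    (0 : Fin 1)
  have e := sipsAdorn_succRule
  exact e ▸ h

lemma adornedBody_succRule : adornedBody succRule bf sips = [ad true fb (x 0) (x 1)] := by
  have : adornedBody succRule bf sips = [adornedAtom (atom true (x 0) (x 1))
      (sipsAdorn (boundHeadVars succRule bf) (sips succRule) 0 (atom true (x 0) (x 1)))] := rfl
  rw [this, sipsAdorn_succRule]; rfl

lemma adornedBody_joinRule :
    adornedBody joinRule bf sips = [ad true bf (x 0) (x 1), ad true bf (x 1) (x 2)] := by
  have : adornedBody joinRule bf sips = [adornedAtom (atom true (x 0) (x 1))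
      (sipsAdorn (boundHeadVars joinRule bf) (sips joinRule) 0 (atom true (x 0) (x 1))),
      adornedAtom (atom true (x 1) (x 2))
      (sipsAdorn (boundHeadVars joinRule bf) (sips joinRule) 1 (atom true (x 1) (x 2)))] := rfl
  rw [this, sipsAdorn_joinRule_zero, sipsAdorn_joinRule_one]; rfl

lemma adornedRule_succRule : adornedRule succRule bf sips = A1 := by
  have : adornedRule succRule bf sips = ⟨magicAtom (atom true (x 1) (x 2)) bf ::
    adornedBody succRule bf sips, ad true bf (x 1) (x 2), {2}⟩ := rfl
  rw [this, adornedBody_succRule, magicAtom_bf]; rfl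

lemma adornedRule_joinRule : adornedRule joinRule bf sips = A2 := by
  have : adornedRule joinRule bf sips = ⟨magicAtom (atom false (x 0) (x 1)) bf ::
    adornedBody joinRule bf sips, ad false bf (x 0) (x 1), ∅⟩ := rfl
  rw [this, adornedBody_joinRule, magicAtom_bf]; rfl

lemma magicRuleFor_succRule : magicRuleFor succRule bf sips (0 : Fin 1) = M1 := by
  have : magicRuleFor succRule bf sips (0 : Fin 1) =
    ⟨magicAtom (atom true (x 1) (x 2)) bf :: (adornedBody succRule bf sips).take 0,
      magicAtom (atom true (x 0) (x 1))
        (sipsAdorn (boundHeadVars succRule bf) (sips succRule) 0 (atom true (x 0) (x 1))), ∅⟩ := rfl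
  rw [this, sipsAdorn_succRule, magicAtom_bf, magicAtom_fb]; rfl

lemma magicRuleFor_joinRule_zero : magicRuleFor joinRule bf sips (0 : Fin 2) = M2 := by
  have : magicRuleFor joinRule bf sips (0 : Fin 2) =
    ⟨magicAtom (atom false (x 0) (x 1)) bf :: (adornedBody joinRule bf sips).take 0,
      magicAtom (atom true (x 0) (x 1))
        (sipsAdorn (boundHeadVars joinRule bf) (sips joinRule) 0 (atom true (x 0) (x 1))), ∅⟩ := rfl
  rw [this, sipsAdorn_joinRule_zero, magicAtom_bf, magicAtom_bf]; rfl

lemma magicRuleFor_joinRule_one : magicRuleFor joinRule bf sips (1 : Fin 2) = M3 := by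
  have : magicRuleFor joinRule bf sips (1 : Fin 2) =
    ⟨magicAtom (atom false (x 0) (x 1)) bf :: (adornedBody joinRule bf sips).take 1,
      magicAtom (atom true (x 1) (x 2))
        (sipsAdorn (boundHeadVars joinRule bf) (sips joinRule) 1 (atom true (x 1) (x 2))), ∅⟩ := rfl
  rw [this, sipsAdorn_joinRule_one, adornedBody_joinRule, magicAtom_bf, magicAtom_bf]; rfl

lemma loadRule_r_bf : loadRule (S := Sch) ℕ ℕ id true bf = L1 := by
  have : loadRule (S := Sch) ℕ ℕ id true bf =
    ⟨[magicAtom (genericAtom (S := Sch) ℕ ℕ id true) bf,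
      ⟨MPred.orig true, (genericAtom (S := Sch) ℕ ℕ id true).args⟩],
      adornedAtom (genericAtom (S := Sch) ℕ ℕ id true) bf, ∅⟩ := rfl
  rw [this, genericAtom_eq, magicAtom_bf]; rfl

lemma loadRule_r_fb : loadRule (S := Sch) ℕ ℕ id true fb = L2 := by
  have : loadRule (S := Sch) ℕ ℕ id true fb =
    ⟨[magicAtom (genericAtom (S := Sch) ℕ ℕ id true) fb,
      ⟨MPred.orig true, (genericAtom (S := Sch) ℕ ℕ id true).args⟩],
      adornedAtom (genericAtom (S := Sch) ℕ ℕ id true) fb, ∅⟩ := rfl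
  rw [this, genericAtom_eq, magicAtom_fb]; rfl

lemma eq_of_mem_rules {σ : Rule (MSchema Sch) ℕ ℕ} (h : σ ∈ mprog.rules) :
    σ = A1 ∨ σ = A2 ∨ σ = M1 ∨ σ = M2 ∨ σ = M3 ∨ σ = L1 ∨ σ = L2 := by
  have key : ∀ (σ : Rule Sch ℕ ℕ) (α : Fin (Sch.arity σ.head.pred) → Bool), σ ∈ prog.rules →
      AdReach prog.rules query sips ⟨σ.head.pred, α⟩ → AdornOK σ α →
      α = bf ∧ (σ = succRule ∨ σ = joinRule) := by
    intro σ α hσ hr hok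
    refine ⟨?_, hσ⟩
    rcases eq_of_adReach hr with h | h | h
    · exact eq_of_heq (Sigma.mk.inj h).2
    · exact eq_of_heq (Sigma.mk.inj h).2
    · rcases hσ with rfl | rfl
      · obtain rfl : α = fb := eq_of_heq (Sigma.mk.inj h).2
        exact absurd hok not_adornOK_succRule
      · exact absurd (congrArg Sigma.fst h) Bool.false_ne_true
  cases h with
  | adorned α hσ hr hok =>
    obtain ⟨rfl, rfl | rfl⟩ := key _ α hσ hr hok
    · exact Or.inl adornedRule_succRule
    · exact Or.inr (Or.inl adornedRule_joinRule)
  | magic α hσ hr hok k =>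
    obtain ⟨rfl, rfl | rfl⟩ := key _ α hσ hr hok
    · change Fin 1 at k
      obtain rfl := Subsingleton.elim k 0
      exact Or.inr (Or.inr (Or.inl magicRuleFor_succRule))
    · change Fin 2 at k
      fin_cases k
      · exact Or.inr (Or.inr (Or.inr (Or.inl magicRuleFor_joinRule_zero)))
      · exact Or.inr (Or.inr (Or.inr (Or.inr (Or.inl magicRuleFor_joinRule_one))))
  | @load p α hr hdata =>
    obtain ⟨A, rfl, rfl⟩ := hdata
    rcases eq_of_adReach hr with h | h | h
    · exact absurd (congrArg Sigma.fst h).symm Bool.false_ne_true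
    · obtain rfl : α = bf := eq_of_heq (Sigma.mk.inj h).2
      exact Or.inr (Or.inr (Or.inr (Or.inr (Or.inr (Or.inl loadRule_r_bf)))))
    · obtain rfl : α = fb := eq_of_heq (Sigma.mk.inj h).2
      exact Or.inr (Or.inr (Or.inr (Or.inr (Or.inr (Or.inr loadRule_r_fb)))))

lemma A1_mem : A1 ∈ mprog.rules :=
  adornedRule_succRule ▸ MagicRuleOf.adorned (σ := succRule) bf (Or.inl rfl) adReach_r_bf
    adornOK_succRule

lemma M1_mem : M1 ∈ mprog.rules :=
  magicRuleFor_succRule ▸ MagicRuleOf.magic (σ := succRule) bf (Or.inl rfl) adReach_r_bf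
    adornOK_succRule (0 : Fin 1)

lemma M2_mem : M2 ∈ mprog.rules :=
  magicRuleFor_joinRule_zero ▸ MagicRuleOf.magic (σ := joinRule) bf (Or.inr rfl) adReach_s_bf
    adornOK_joinRule (0 : Fin 2)

lemma M3_mem : M3 ∈ mprog.rules :=
  magicRuleFor_joinRule_one ▸ MagicRuleOf.magic (σ := joinRule) bf (Or.inr rfl) adReach_s_bf
    adornOK_joinRule (1 : Fin 2)

lemma L2_mem : L2 ∈ mprog.rules :=
  loadRule_r_fb ▸ MagicRuleOf.load (S := Sch) (D := prog.db) (p := true) (α := fb) adReach_r_fb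
    ⟨atom true 1 0, rfl, rfl⟩

/-- The position `p^α[i]`. -/
abbrev adPos (p : Bool) (α : Fin 2 → Bool) (i : Fin 2) : Position (MSchema Sch) :=
  ⟨.adorned p α, i⟩

/-- The position `mg_p^α[j]`. -/
abbrev mgPos (p : Bool) (α : Fin 2 → Bool) (j : Fin (boundCount α)) : Position (MSchema Sch) :=
  ⟨.magic p α, j⟩

lemma specPath_mg_bf (k : ℕ) (j : Fin (boundCount bf)) :
    SpecPath mprog.rules (mgPos true bf j) k := by
  induction k with
  | zero => exact .refl _
  | succ k ih =>
    have h₁ : dgSpecial mprog.rules (mgPos true bf j) (adPos true bf 1) :=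
      ⟨A1, A1_mem, ⟨1, by simp [A1], by simp [A1, Rule.occursInHead],
        mg true bf (x 1), by simp [A1], j, rfl, rfl⟩, 2, rfl, (1 : Fin 2), rfl, rfl⟩
    have h₂ : dgEdge mprog.rules (adPos true bf 1) (mgPos true bf j) :=
      ⟨M3, M3_mem, 1, by simp [M3], by simp [M3, Rule.occursInHead],
        ⟨ad true bf (x 0) (x 1), by simp [M3], (1 : Fin 2), rfl, rfl⟩, j, rfl, rfl⟩
    exact (ih.special h₁).edge h₂

lemma specPath_ad_bf (k : ℕ) : SpecPath mprog.rules (adPos true bf 0) k :=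
  (specPath_mg_bf k jbf).edge ⟨A1, A1_mem, 1, by simp [A1], by simp [A1, Rule.occursInHead],
    ⟨mg true bf (x 1), by simp [A1], jbf, rfl, rfl⟩, (0 : Fin 2), rfl, rfl⟩

lemma specPath_ad_fb (k : ℕ) : SpecPath mprog.rules (adPos true fb 1) k := by
  have h₁ : dgEdge mprog.rules (mgPos true bf jbf) (mgPos true fb jfb) :=
    ⟨M1, M1_mem, 1, by simp [M1], by simp [M1, Rule.occursInHead],
      ⟨mg true bf (x 1), by simp [M1], jbf, rfl, rfl⟩, jfb, rfl, rfl⟩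
  have h₂ : dgEdge mprog.rules (mgPos true fb jfb) (adPos true fb 1) :=
    ⟨L2, L2_mem, 1, by simp [L2], by simp [L2, Rule.occursInHead],
      ⟨mg true fb (x 1), by simp [L2], jfb, rfl, rfl⟩, (1 : Fin 2), rfl, rfl⟩
  exact ((specPath_mg_bf k jbf).edge h₁).edge h₂

lemma not_mem_PiF {π : Position (MSchema Sch)} (h : ∀ k, SpecPath mprog.rules π k) :
    π ∉ PiF mprog.rules := fun ⟨n, hn⟩ => absurd (hn (n + 1) (h _)) (by omega)

lemma varPos_A1 : ∀ π ∈ A1.varPos 1, π ∉ PiF mprog.rules := by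
  rintro π (⟨A, hA, i, hi, rfl⟩ | ⟨i, hi, rfl⟩)
  · simp only [A1, List.mem_cons, List.not_mem_nil, or_false] at hA
    rcases hA with rfl | rfl
    · exact not_mem_PiF fun k => specPath_mg_bf k i
    · change Fin 2 at i
      fin_cases i
      · exact absurd (Sum.inl.inj hi) (by decide)
      · exact not_mem_PiF specPath_ad_fb
  · change Fin 2 at i
    fin_cases i
    · exact not_mem_PiF specPath_ad_bf
    · exact absurd (Sum.inl.inj hi) (by decide)

lemma repeatedInBody_A1 : A1.repeatedInBody 1 :=
  ⟨(0 : Fin 2), (1 : Fin 2), jbf, (1 : Fin 2), rfl, rfl,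
    fun h => absurd (congrArg (fun s => s.1.val) h) (by decide)⟩

lemma marked_A1 : Marked mprog.rules A1 1 := by
  have h : Marked mprog.rules M3 0 :=
    .prelim M3_mem (by simp [M3, Rule.occursInBody]) (by simp [M3, Rule.occursInHead])
  exact .prop (π := adPos true bf 0) M3_mem h
    ⟨ad true bf (x 0) (x 1), by simp [M3], (0 : Fin 2), rfl, rfl⟩ A1_mem
    ⟨(0 : Fin 2), rfl, rfl⟩ (by simp [A1, Rule.occursInBody])

lemma not_ws_mprog : ¬ WS mprog.rules := fun h =>
  (h A1 A1_mem 1 repeatedInBody_A1).elim (fun h => h marked_A1)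
    fun ⟨π, hπ, hF⟩ => varPos_A1 π hπ hF

/-- A value that is the constant `n`. -/
abbrev cst (n : ℕ) : Val ℕ ℕ := Sum.inl n
/-- A value that is the null `n`. -/
abbrev nul (n : ℕ) : Val ℕ ℕ := Sum.inr n

/-- The assignment with `0 ↦ a`, `1 ↦ b`, and every other variable sent to `c`. -/
def assign (a b c : Val ℕ ℕ) : ℕ → Val ℕ ℕ
  | 0 => a
  | 1 => b
  | _ => c

@[simp] lemma assign_zero (a b c : Val ℕ ℕ) : assign a b c 0 = a := rfl
@[simp] lemma assign_one (a b c : Val ℕ ℕ) : assign a b c 1 = b := rfl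
@[simp] lemma assign_two (a b c : Val ℕ ℕ) : assign a b c 2 = c := rfl

/-- The rule applications of the chase of `mprog`. -/
def steps : ℕ → Option (Rule (MSchema Sch) ℕ ℕ × (ℕ → Val ℕ ℕ))
  | 0 => some (M2, assign (cst 0) (cst 0) (cst 0))
  | 1 => some (M1, assign (cst 0) (cst 0) (cst 0))
  | 2 => some (L2, assign (cst 1) (cst 0) (cst 0))
  | 3 => some (A1, assign (cst 1) (cst 0) (nul 0))
  | 4 => some (M3, assign (cst 0) (nul 0) (nul 0))
  | 5 => some (M1, assign (nul 0) (nul 0) (nul 0))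
  | _ => none

/-- The instances of the chase of `mprog`. -/
def insts : ℕ → Instance (MSchema Sch) ℕ ℕ
  | 0 => {og true (cst 1) (cst 0), mg false bf (cst 0)}
  | n + 1 => match steps n with
    | none => insts n
    | some (σ, θ) => insert (σ.head.subst θ) (insts n)

lemma dbInst_mprog : mprog.dbInst = insts 0 := by
  have h : seedFact (S := Sch) (V := ℕ) 0 (atom false (Sum.inr 0) (x 0)) = mg false bf 0 := by
    unfold seedFact
    rw [queryAdorn_query]
    have harg : ∀ i : Fin 2, i = 0 → (atom false (Sum.inr 0) (x 0)).args i = Sum.inr 0 := by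
      rintro _ rfl; rfl
    refine congrArg (Atom.mk (S := MSchema Sch) (MPred.magic false bf)) (funext fun j => ?_)
    have hj := harg _ (boundEnum_bf j)
    split
    · rename_i h
      exact Sum.inr.inj (h.symm.trans hj)
    · rfl
  have hdb : mprog.db = {og true 1 0, mg false bf 0} := by
    have h' : mprog.db = (fun A : Atom Sch ℕ => (⟨MPred.orig A.pred, A.args⟩ :
        Atom (MSchema Sch) ℕ)) '' {atom true 1 0} ∪
        (fun A => seedFact 0 A) '' {A | A ∈ [atom false (Sum.inr 0) (x 0)]} := rfl
    have hs : {A | A ∈ [atom false (Sum.inr 0) (x 0)]} = {atom false (Sum.inr 0) (x 0)} := by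
      ext; simp
    rw [h', hs, Set.image_singleton, Set.image_singleton, h]; rfl
  rw [Program.dbInst, hdb]
  simp [Set.image_pair, insts]

lemma insts_mono : Monotone insts := by
  refine monotone_nat_of_le_succ fun n => ?_
  rw [insts]
  split
  · exact le_rfl
  · exact Set.subset_insert _ _

lemma insts_add_six (n : ℕ) : insts (n + 6) = insts 6 := by
  induction n with
  | zero => rfl
  | succ n ih => rw [← ih]; rfl

lemma insts_subset (n : ℕ) : insts n ⊆ insts 6 :=
  (insts_mono (Nat.le_add_right n 6)).trans (insts_add_six n).le

@[simp] lemma subst_og (θ : ℕ → Val ℕ ℕ) (p : Bool) (t u : RTerm ℕ ℕ) :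
    (og p t u).subst θ = og p (substT θ t) (substT θ u) := map_og ..
@[simp] lemma subst_ad (θ : ℕ → Val ℕ ℕ) (p : Bool) (α : Fin 2 → Bool) (t u : RTerm ℕ ℕ) :
    (ad p α t u).subst θ = ad p α (substT θ t) (substT θ u) := map_ad ..
@[simp] lemma subst_mg (θ : ℕ → Val ℕ ℕ) (p : Bool) (α : Fin 2 → Bool) (t : RTerm ℕ ℕ) :
    (mg p α t).subst θ = mg p α (substT θ t) := rfl
@[simp] lemma substT_x (θ : ℕ → Val ℕ ℕ) (n : ℕ) : substT (C := ℕ) θ (x n) = θ n := rfl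

lemma steps_sound (n : ℕ) (σ : Rule (MSchema Sch) ℕ ℕ) (θ : ℕ → Val ℕ ℕ)
    (h : steps n = some (σ, θ)) :
    σ ∈ mprog.rules ∧ bodySat (insts n) σ.body θ ∧
    (∀ Z ∈ σ.exVars, ∃ ν : ℕ, θ Z = Sum.inr ν ∧ (Sum.inr ν : Val ℕ ℕ) ∉ adom (insts n)) ∧
    (∀ Z ∈ σ.exVars, ∀ Z' ∈ σ.exVars, θ Z = θ Z' → Z = Z') ∧
    insts (n + 1) = insert (σ.head.subst θ) (insts n) := by
  have hins : insts (n + 1) = insert (σ.head.subst θ) (insts n) := by rw [insts, h]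
  match n, h with
  | 0, rfl => exact ⟨M2_mem, by simp [bodySat, M2, insts], by simp [M2], by simp [M2], hins⟩
  | 1, rfl => exact ⟨M1_mem, by simp [bodySat, M1, M2, insts, steps], by simp [M1], by simp [M1],
      hins⟩
  | 2, rfl => exact ⟨L2_mem, by simp [bodySat, L2, M1, insts, steps], by simp [L2], by simp [L2],
      hins⟩
  | 3, rfl =>
    refine ⟨A1_mem, by simp [bodySat, A1, L2, M1, M2, insts, steps], ?_, by simp [A1], hins⟩
    rintro Z rfl
    exact ⟨0, rfl, by simp [adom, insts, steps, L2, M1, M2]⟩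
  | 4, rfl => exact ⟨M3_mem, by simp [bodySat, M3, A1, L2, M1, M2, insts, steps], by simp [M3],
      by simp [M3], hins⟩
  | 5, rfl => exact ⟨M1_mem, by simp [bodySat, M3, M1, insts, steps], by simp [M1], by simp [M1],
      hins⟩

lemma steps_once (m n : ℕ) (σ : Rule (MSchema Sch) ℕ ℕ) (θ θ' : ℕ → Val ℕ ℕ)
    (hm : steps m = some (σ, θ)) (hn : steps n = some (σ, θ'))
    (h : ∀ X, σ.occursInBody X → θ X = θ' X) : m = n := by
  have hM : M1.occursInBody 1 := by simp [M1, Rule.occursInBody]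
  match m, hm with
  | 0, rfl =>
    match n, hn with
    | 0, _ => rfl
    | 1, hn | 2, hn | 3, hn | 4, hn | 5, hn => simp [steps, A1, M1, M2, M3, L2] at hn
  | 1, rfl =>
    match n, hn with
    | 1, _ => rfl
    | 0, hn | 2, hn | 3, hn | 4, hn => simp [steps, A1, M1, M2, M3, L2] at hn
    | 5, rfl => exact absurd (h 1 hM) (by simp)
  | 2, rfl =>
    match n, hn with
    | 2, _ => rfl
    | 0, hn | 1, hn | 3, hn | 4, hn | 5, hn => simp [steps, A1, M1, M2, M3, L2] at hn
  | 3, rfl =>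
    match n, hn with
    | 3, _ => rfl
    | 0, hn | 1, hn | 2, hn | 4, hn | 5, hn => simp [steps, A1, M1, M2, M3, L2] at hn
  | 4, rfl =>
    match n, hn with
    | 4, _ => rfl
    | 0, hn | 1, hn | 2, hn | 3, hn | 5, hn => simp [steps, A1, M1, M2, M3, L2] at hn
  | 5, rfl =>
    match n, hn with
    | 5, _ => rfl
    | 0, hn | 2, hn | 3, hn | 4, hn => simp [steps, A1, M1, M2, M3, L2] at hn
    | 1, rfl => exact absurd (h 1 hM) (by simp)

lemma mem_insts_six (A : Atom (MSchema Sch) (Val ℕ ℕ)) :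
    A ∈ insts 6 ↔ A = mg true fb (nul 0) ∨ A = mg true bf (nul 0) ∨
      A = ad true bf (cst 0) (nul 0) ∨ A = ad true fb (cst 1) (cst 0) ∨
      A = mg true fb (cst 0) ∨ A = mg true bf (cst 0) ∨
      A = og true (cst 1) (cst 0) ∨ A = mg false bf (cst 0) := by
  simp [insts, steps, A1, M1, M2, M3, L2]

lemma steps_fair (n : ℕ) (σ : Rule (MSchema Sch) ℕ ℕ) (θ : ℕ → Val ℕ ℕ) (hσ : σ ∈ mprog.rules)
    (h : bodySat (insts n) σ.body θ) :
    ∃ m θ', steps m = some (σ, θ') ∧ ∀ X, σ.occursInBody X → θ' X = θ X := by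
  have h : bodySat (insts 6) σ.body θ := fun A hA => insts_subset n (h A hA)
  rcases eq_of_mem_rules hσ with rfl | rfl | rfl | rfl | rfl | rfl | rfl <;>
    simp [bodySat, A1, A2, M1, M2, M3, L1, L2, mem_insts_six] at h
  · refine ⟨3, _, rfl, ?_⟩
    simp [Rule.occursInBody, A1]
    grind [assign_zero, assign_one]
  · grind
  · rcases h with h | h
    · refine ⟨5, _, rfl, ?_⟩
      simp [Rule.occursInBody, M1]
      grind [assign_zero, assign_one]
    · refine ⟨1, _, rfl, ?_⟩
      simp [Rule.occursInBody, M1]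
      grind [assign_zero, assign_one]
  · refine ⟨0, _, rfl, ?_⟩
    simp [Rule.occursInBody, M2]
    grind [assign_zero, assign_one]
  · refine ⟨4, _, rfl, ?_⟩
    simp [Rule.occursInBody, M3]
    grind [assign_zero, assign_one]
  · grind
  · refine ⟨2, _, rfl, ?_⟩
    simp [Rule.occursInBody, L2]
    grind [assign_zero, assign_one]

/-- A chase sequence of `mprog`. -/
def chase : ChaseSeq mprog where
  inst := insts
  stepAt := steps
  init := dbInst_mprog.symm
  step_none n h := by rw [insts, h]
  step_some := steps_sound
  once := steps_once
  fair := steps_fair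

lemma not_stickyOn_chase : ¬ chase.stickyOn (PiF mprog.rules) := by
  intro h
  have h₁ := (h 3 A1 _ rfl 1 repeatedInBody_A1 varPos_A1).2 (mg true bf (nul 0))
  have h₂ : dchase chase (A1.head.subst (assign (cst 1) (cst 0) (nul 0))) (mg true bf (nul 0)) :=
    .single ⟨4, M3, _, rfl, ⟨ad true bf (x 0) (x 1), by simp [M3], by simp [A1]⟩, by simp [M3]⟩
  simpa using h₁ h₂

end Datalog.MagicCounterexample

open Datalog in
/-- the class of weakly-sticky programs is not closed under MagicD⁺: there are
a WS program `P` and a CQ `Q` whose rewriting `P_m` is neither WS nor in `SCh(S^rank)`. -/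
theorem ws_not_closed_under_magic :
    ∃ (S : Schema) (V C Nl : Type) (c₀ : C) (P : Program S V C Nl) (Q : CQ S V C)
      (sips : Rule S V C → List (Atom S (RTerm V C))) (vemb : ℕ → V),
      Infinite C ∧ Infinite Nl ∧
      (∀ σ : Rule S V C, (sips σ).Perm σ.body) ∧ Function.Injective vemb ∧
      P.rules.Finite ∧ P.db.Finite ∧ WS P.rules ∧
      ¬ WS (magicProgram c₀ P Q sips vemb).rules ∧
      magicProgram c₀ P Q sips vemb ∉
        SCh (fun Pm : Program (MSchema S) V C Nl => PiF Pm.rules) := by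
  open MagicCounterexample in
  exact ⟨Sch, ℕ, ℕ, ℕ, 0, prog, query, sips, id, inferInstance, inferInstance,
    fun _ => List.Perm.refl _, Function.injective_id, Set.toFinite {succRule, joinRule},
    Set.finite_singleton _,
    ws_prog, not_ws_mprog, fun h => not_stickyOn_chase (h chase)⟩
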